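/- Let θ be a real number and suppose G is θ-elementary. Let S be a nonempty θ-barrier set of G and let X be a nonempty subset of S. Then A_θ(G\X) = S\X, and every vertex of G\X is either θ-essential or θ-special (i.e., P_θ(G\X) ∪ N_θ(G\X) = ∅). -/

import Mathlib

open Polynomial

namespace MatchPoly

variable {V : Type*}

/-- The number of `r`-matchings in `G`: sets of `r` edges, no two sharing a vertex. -/
noncomputable def numMatchings (G : SimpleGraph V) (r : ℕ) : ℕ :=
  Nat.card {M : Finset (Sym2 V) // M.card = r ∧ (M : Set (Sym2 V)) ⊆ G.edgeSet ∧
    (M : Set (Sym2 V)).Pairwise fun e f => ∀ v : V, v ∈ e → v ∉ f}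

/-- The matching polynomial `μ(G,x) = ∑ (-1)^r p(G,r) x^(n-2r)`. -/
noncomputable def matchingPoly (G : SimpleGraph V) : Polynomial ℝ :=
  ∑ r ∈ Finset.range (Nat.card V + 1),
    Polynomial.C ((-1 : ℝ) ^ r * (numMatchings G r : ℝ)) *
      (Polynomial.X : Polynomial ℝ) ^ (Nat.card V - 2 * r)

/-- `mult θ G`: the multiplicity of `θ` as a root of `μ(G,x)`. -/
noncomputable def mult (θ : ℝ) (G : SimpleGraph V) : ℕ :=
  (matchingPoly G).rootMultiplicity θ

/-- `G \ X`: the induced subgraph on the complement of the vertex set `X`. -/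
def deleteSet (G : SimpleGraph V) (X : Set V) : SimpleGraph ↥(Xᶜ) :=
  G.induce (Xᶜ)

/-- `G \ v`: delete a single vertex. -/
def deleteVert (G : SimpleGraph V) (v : V) : SimpleGraph ↥({v}ᶜ : Set V) :=
  G.induce ({v}ᶜ : Set V)

/-- `u` is θ-essential: `mult(θ, G\u) = mult(θ,G) - 1`. -/
def IsEssential (θ : ℝ) (G : SimpleGraph V) (u : V) : Prop :=
  mult θ (deleteVert G u) + 1 = mult θ G

/-- `u` is θ-neutral: `mult(θ, G\u) = mult(θ,G)`. -/
def IsNeutral (θ : ℝ) (G : SimpleGraph V) (u : V) : Prop :=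
  mult θ (deleteVert G u) = mult θ G

/-- `u` is θ-positive: `mult(θ, G\u) = mult(θ,G) + 1`. -/
def IsPositive (θ : ℝ) (G : SimpleGraph V) (u : V) : Prop :=
  mult θ (deleteVert G u) = mult θ G + 1

/-- `u` is θ-special: not θ-essential but adjacent to a θ-essential vertex. -/
def IsSpecial (θ : ℝ) (G : SimpleGraph V) (u : V) : Prop :=
  ¬ IsEssential θ G u ∧ ∃ w : V, G.Adj u w ∧ IsEssential θ G w

/-- `A_θ(G)`: the set of θ-special vertices. -/
def specialSet (θ : ℝ) (G : SimpleGraph V) : Set V := {u | IsSpecial θ G u}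

/-- `N_θ(G)`: the set of θ-neutral vertices. -/
def neutralSet (θ : ℝ) (G : SimpleGraph V) : Set V := {u | IsNeutral θ G u}

/-- `P_θ(G)`: the set of θ-positive vertices that are not θ-special. -/
def positiveSet (θ : ℝ) (G : SimpleGraph V) : Set V :=
  {u | IsPositive θ G u ∧ ¬ IsSpecial θ G u}

/-- `G` is θ-super positive: `mult(θ,G) = 0` and `mult(θ,G\v) = 1` for every vertex `v`. -/
def IsSuperPositive (θ : ℝ) (G : SimpleGraph V) : Prop :=
  mult θ G = 0 ∧ ∀ v : V, mult θ (deleteVert G v) = 1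

/-- `G` is θ-elementary: θ-super positive and `P_θ(G\v) = ∅` for every vertex `v`. -/
def IsElementary (θ : ℝ) (G : SimpleGraph V) : Prop :=
  IsSuperPositive θ G ∧ ∀ v : V, positiveSet θ (deleteVert G v) = ∅

/-- `G` is θ-critical: every vertex is θ-essential and `mult(θ,G) = 1`. -/
def IsCritical (θ : ℝ) (G : SimpleGraph V) : Prop :=
  (∀ v : V, IsEssential θ G v) ∧ mult θ G = 1

/-- `c_θ(G)`: the number of θ-critical connected components of `G`. -/
noncomputable def numCritComponents (θ : ℝ) (G : SimpleGraph V) : ℕ :=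
  Nat.card {c : G.ConnectedComponent // IsCritical θ (G.induce c.supp)}

/-- `X` is a θ-barrier set: `mult(θ,G) = c_θ(G\X) - |X|`. -/
def IsBarrier (θ : ℝ) (G : SimpleGraph V) (X : Set V) : Prop :=
  numCritComponents θ (deleteSet G X) = mult θ G + X.ncard

/-- `X` is a θ-extreme set: `mult(θ,G\X) = mult(θ,G) + |X|`. -/
def IsExtreme (θ : ℝ) (G : SimpleGraph V) (X : Set V) : Prop :=
  mult θ (deleteSet G X) = mult θ G + X.ncard

/-- `G` is θ-base: θ-super positive and no θ-barrier set contains two adjacent vertices. -/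
def IsBase (θ : ℝ) (G : SimpleGraph V) : Prop :=
  IsSuperPositive θ G ∧
    ∀ X : Set V, IsBarrier θ G X → ∀ u v : V, u ∈ X → v ∈ X → ¬ G.Adj u v


open Classical in
/-- The matchings of `G` (as sets of edges) all of whose edges lie inside `S`. -/
noncomputable def matchingsIn [Fintype V] (G : SimpleGraph V) (S : Finset V) :
    Finset (Finset (Sym2 V)) :=
  Finset.univ.filter fun M => (M : Set (Sym2 V)) ⊆ G.edgeSet ∧
    ((M : Set (Sym2 V)).Pairwise fun e f => ∀ v : V, v ∈ e → v ∉ f) ∧ ∀ e ∈ M, ∀ v ∈ e, v ∈ S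

open Classical in
/-- The vertex-weighted matching polynomial of `G[S]`: each matching contributes its sign times
the product of the weights of the vertices of `S` it leaves uncovered. -/
noncomputable def weightedPoly [Fintype V] {R : Type*} [CommRing R] (G : SimpleGraph V)
    (x : V → R) (S : Finset V) : R :=
  ∑ M ∈ matchingsIn G S, (-1) ^ M.card * ∏ v ∈ S with ∀ e ∈ M, v ∉ e, x v

section Recurrence

open Classical

variable [Fintype V] {R : Type*} [CommRing R] (G : SimpleGraph V)

theorem mem_matchingsIn {G : SimpleGraph V} {S : Finset V} {M : Finset (Sym2 V)} :
    M ∈ matchingsIn G S ↔ (M : Set (Sym2 V)) ⊆ G.edgeSet ∧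
      ((M : Set (Sym2 V)).Pairwise fun e f => ∀ v : V, v ∈ e → v ∉ f) ∧
        ∀ e ∈ M, ∀ v ∈ e, v ∈ S := by
  simp [matchingsIn]

theorem weightedPoly_empty (x : V → R) : weightedPoly G x ∅ = 1 := by
  have h : matchingsIn G (∅ : Finset V) = {∅} := by
    ext M
    simp only [mem_matchingsIn, Finset.mem_singleton]
    constructor
    · rintro ⟨-, -, h⟩
      refine Finset.eq_empty_of_forall_notMem fun e he => ?_
      induction e with
      | h a b => exact absurd (h _ he a (by simp)) (by simp)
    · rintro rfl
      simp
  simp [weightedPoly, h]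

theorem filter_uncovered_matchingsIn {S : Finset V} (u : V) :
    ((matchingsIn G S).filter fun M => ∀ e ∈ M, u ∉ e) = matchingsIn G (S.erase u) := by
  ext M
  simp only [Finset.mem_filter, mem_matchingsIn, Finset.mem_erase]
  constructor
  · rintro ⟨⟨h1, h2, h3⟩, h4⟩
    exact ⟨h1, h2, fun e he v hv => ⟨fun h => h4 e he (h ▸ hv), h3 e he v hv⟩⟩
  · rintro ⟨h1, h2, h3⟩
    exact ⟨⟨h1, h2, fun e he v hv => (h3 e he v hv).2⟩, fun e he hu => (h3 e he u hu).1 rfl⟩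

theorem filter_covered_matchingsIn {S : Finset V} (u : V) :
    ((matchingsIn G S).filter fun M => ¬ ∀ e ∈ M, u ∉ e) =
      ((S.erase u).filter (G.Adj u)).biUnion fun i =>
        (matchingsIn G S).filter fun M => s(u, i) ∈ M := by
  ext M
  simp only [Finset.mem_filter, Finset.mem_biUnion, Finset.mem_erase]
  constructor
  · rintro ⟨hM, h⟩
    push Not at h
    obtain ⟨e, he, hu⟩ := h
    obtain ⟨i, rfl⟩ := Sym2.mem_iff_exists.mp hu
    have hM' := mem_matchingsIn.mp hM
    have hadj : G.Adj u i := hM'.1 he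
    exact ⟨i, ⟨⟨hadj.ne', hM'.2.2 _ he i (by simp)⟩, hadj⟩, hM, he⟩
  · rintro ⟨i, -, hM, he⟩
    exact ⟨hM, fun h => h _ he (by simp)⟩

theorem sum_matchingsIn_containing (x : V → R) {S : Finset V} {u i : V} (hu : u ∈ S)
    (hi : i ∈ S) (hadj : G.Adj u i) :
    ∑ M ∈ matchingsIn G S with s(u, i) ∈ M,
        (-1) ^ M.card * ∏ v ∈ S with ∀ e ∈ M, v ∉ e, x v =
      -weightedPoly G x ((S.erase u).erase i) := by
  rw [weightedPoly, ← Finset.sum_neg_distrib]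
  refine Finset.sum_bij' (fun M _ => M.erase s(u, i)) (fun M _ => insert s(u, i) M) ?_ ?_ ?_ ?_ ?_
  · intro M hM
    simp only [Finset.mem_filter, mem_matchingsIn] at hM
    obtain ⟨⟨h1, h2, h3⟩, he⟩ := hM
    rw [mem_matchingsIn]
    refine ⟨fun e h => h1 (Finset.mem_of_mem_erase h),
      fun e h f h' => h2 (Finset.mem_of_mem_erase h) (Finset.mem_of_mem_erase h'), ?_⟩
    intro e hh v hv
    rw [Finset.mem_erase] at hh
    have := h2 hh.2 he hh.1 v hv
    simp only [Sym2.mem_iff, not_or] at this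
    simp [this, h3 e hh.2 v hv]
  · intro M hM
    rw [mem_matchingsIn] at hM
    obtain ⟨h1, h2, h3⟩ := hM
    simp only [Finset.mem_filter, mem_matchingsIn, Finset.mem_insert_self, and_true]
    refine ⟨?_, ?_, ?_⟩
    · intro e he
      rw [Finset.mem_coe, Finset.mem_insert] at he
      rcases he with rfl | he
      · exact hadj
      · exact h1 he
    · rw [Finset.coe_insert]
      refine h2.insert_of_notMem ?_ ?_
      · intro h
        simpa using h3 _ h u (by simp)
      · intro f hf
        refine ⟨fun v hv hvf => ?_, fun v hv hvf => ?_⟩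
        · have := h3 f hf v hvf
          simp only [Sym2.mem_iff] at hv
          rcases hv with rfl | rfl <;> simp at this
        · have := h3 f hf v hv
          simp only [Sym2.mem_iff] at hvf
          rcases hvf with rfl | rfl <;> simp at this
    · intro e he v hv
      rw [Finset.mem_insert] at he
      rcases he with rfl | he
      · simp only [Sym2.mem_iff] at hv
        rcases hv with rfl | rfl <;> assumption
      · have := h3 e he v hv
        simp only [Finset.mem_erase] at this
        exact this.2.2
  · intro M hM
    exact Finset.insert_erase (Finset.mem_filter.mp hM).2
  · intro M hM
    refine Finset.erase_insert fun h => ?_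
    simpa using (mem_matchingsIn.mp hM).2.2 _ h u (by simp)
  · intro M hM
    obtain ⟨hM, he⟩ := Finset.mem_filter.mp hM
    have hc : M.card = (M.erase s(u, i)).card + 1 := (Finset.card_erase_add_one he).symm
    have hset : (S.filter fun v => ∀ e ∈ M, v ∉ e) =
        ((S.erase u).erase i).filter fun v => ∀ e ∈ M.erase s(u, i), v ∉ e := by
      ext v
      simp only [Finset.mem_filter, Finset.mem_erase]
      constructor
      · rintro ⟨hv, h⟩
        have h' := h _ he
        simp only [Sym2.mem_iff, not_or] at h'
        exact ⟨⟨h'.2, h'.1, hv⟩, fun e hh => h e hh.2⟩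
      · rintro ⟨⟨h1, h2, hv⟩, h⟩
        refine ⟨hv, fun e hh => ?_⟩
        by_cases hee : e = s(u, i)
        · simp [hee, h1, h2]
        · exact h e ⟨hee, hh⟩
    rw [hset, hc, pow_succ]
    ring

/-- The vertex recurrence for the weighted matching polynomial. -/
theorem weightedPoly_recurrence (x : V → R) {S : Finset V} {u : V} (hu : u ∈ S) :
    weightedPoly G x S = x u * weightedPoly G x (S.erase u) -
      ∑ i ∈ (S.erase u).filter (G.Adj u), weightedPoly G x ((S.erase u).erase i) := by
  conv_lhs => rw [weightedPoly]
  rw [← Finset.sum_filter_add_sum_filter_not _ (fun M => ∀ e ∈ M, u ∉ e), sub_eq_add_neg]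
  congr 1
  · rw [filter_uncovered_matchingsIn, weightedPoly, Finset.mul_sum]
    refine Finset.sum_congr rfl fun M hM => ?_
    have h : (S.filter fun v => ∀ e ∈ M, v ∉ e) =
        insert u ((S.erase u).filter fun v => ∀ e ∈ M, v ∉ e) := by
      rw [Finset.filter_erase, Finset.insert_erase]
      exact Finset.mem_filter.mpr ⟨hu, fun e he h => by
        simpa using (mem_matchingsIn.mp hM).2.2 e he u h⟩
    rw [h, Finset.prod_insert (by simp)]
    ring
  · rw [filter_covered_matchingsIn, Finset.sum_biUnion, ← Finset.sum_neg_distrib]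
    · refine Finset.sum_congr rfl fun i hi => ?_
      simp only [Finset.mem_filter, Finset.mem_erase] at hi
      exact sum_matchingsIn_containing G x hu hi.1.2 hi.2
    · intro i _ j _ hij
      refine Finset.disjoint_left.mpr fun M hi hj => ?_
      obtain ⟨hM, hi⟩ := Finset.mem_filter.mp hi
      obtain ⟨-, hj⟩ := Finset.mem_filter.mp hj
      refine (mem_matchingsIn.mp hM).2.1 hi hj (fun h => hij (Sym2.congr_right.mp h)) u
        (by simp) (by simp)

theorem map_weightedPoly {R' : Type*} [CommRing R'] (φ : R →+* R') (x : V → R) (S : Finset V) :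
    φ (weightedPoly G x S) = weightedPoly G (fun v => φ (x v)) S := by
  simp [weightedPoly, map_sum, map_prod]

theorem weightedPoly_congr {x y : V → R} {S : Finset V} (h : ∀ v ∈ S, x v = y v) :
    weightedPoly G x S = weightedPoly G y S := by
  refine Finset.sum_congr rfl fun M _ => ?_
  congr 1
  exact Finset.prod_congr rfl fun v hv => h v (Finset.mem_filter.mp hv).1

/-- The weighted matching polynomial is affine in the weight of each vertex. -/
theorem weightedPoly_update_add (x : V → R) {S : Finset V} {w : V} (hw : w ∈ S) (y : R) :
    weightedPoly G (Function.update x w (x w + y)) S =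
      weightedPoly G x S + y * weightedPoly G x (S.erase w) := by
  have h : ∀ T : Finset V, w ∉ T →
      weightedPoly G (Function.update x w (x w + y)) T = weightedPoly G x T := fun T hT =>
    weightedPoly_congr G fun v hv => Function.update_of_ne (fun h => hT (by rwa [h] at hv)) _ _
  rw [weightedPoly_recurrence G _ hw, weightedPoly_recurrence G x hw, h _ (by simp),
    Finset.sum_congr rfl fun i _ => h _ (by simp)]
  simp only [Function.update_self]
  ring

/-- Multiplicativity over parts with no edges between them. -/
theorem weightedPoly_union (x : V → R) {S T : Finset V} (hd : Disjoint S T)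
    (hST : ∀ a ∈ S, ∀ b ∈ T, ¬ G.Adj a b) :
    weightedPoly G x (S ∪ T) = weightedPoly G x S * weightedPoly G x T := by
  induction S using Finset.strongInduction with
  | H S ih =>
    rcases S.eq_empty_or_nonempty with rfl | ⟨u, hu⟩
    · simp [weightedPoly_empty]
    · have huT : u ∉ T := Finset.disjoint_left.mp hd hu
      have hsub : ∀ A ⊂ S, weightedPoly G x (A ∪ T) = weightedPoly G x A * weightedPoly G x T :=
        fun A hA => ih A hA (hd.mono_left hA.1) fun a ha => hST a (hA.1 ha)
      have h1 : (S ∪ T).erase u = S.erase u ∪ T := by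
        rw [Finset.erase_union_distrib, Finset.erase_eq_of_notMem huT]
      have h2 : ((S.erase u ∪ T).filter (G.Adj u)) = (S.erase u).filter (G.Adj u) := by
        rw [Finset.filter_union, Finset.filter_false_of_mem (hST u hu), Finset.union_empty]
      rw [weightedPoly_recurrence G x (Finset.mem_union_left T hu),
        weightedPoly_recurrence G x hu, h1, h2, hsub _ (Finset.erase_ssubset hu), sub_mul,
        Finset.sum_mul, mul_assoc]
      congr 1
      refine Finset.sum_congr rfl fun i hi => ?_
      have hiS := (Finset.mem_filter.mp hi).1
      rw [Finset.erase_union_distrib, Finset.erase_eq_of_notMem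
        (Finset.disjoint_left.mp hd (Finset.mem_of_mem_erase hiS))]
      exact hsub _ ((Finset.erase_ssubset hiS).trans (Finset.erase_ssubset hu))

theorem weightedPoly_map {W : Type*} [Fintype W] {H : SimpleGraph W} (f : H ↪g G) (x : V → R)
    (S : Finset W) :
    weightedPoly H (fun w => x (f w)) S = weightedPoly G x (S.map f.toEmbedding) := by
  induction S using Finset.strongInduction with
  | H S ih =>
    rcases S.eq_empty_or_nonempty with rfl | ⟨u, hu⟩
    · simp [weightedPoly_empty]
    · have hfu : f u ∈ S.map f.toEmbedding := Finset.mem_map_of_mem f.toEmbedding hu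
      have he : ∀ (A : Finset W) (a : W),
          (A.map f.toEmbedding).erase (f a) = (A.erase a).map f.toEmbedding := fun A a =>
        (Finset.map_erase f.toEmbedding A a).symm
      rw [weightedPoly_recurrence H _ hu, weightedPoly_recurrence G x hfu, he,
        ih _ (Finset.erase_ssubset hu), Finset.filter_map, Finset.sum_map]
      congr 1
      refine Finset.sum_congr ?_ fun i hi => ?_
      · ext i
        simp
      · have hiS := (Finset.mem_filter.mp hi).1
        rw [ih _ ((Finset.erase_ssubset hiS).trans (Finset.erase_ssubset hu))]
        exact congrArg _ (he _ _).symm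

end Recurrence

section Rayleigh

open Classical

variable [Fintype V] (G : SimpleGraph V)

/-- The Rayleigh difference of a pair of vertices expands along the neighbours of the first. -/
theorem rayleigh_expand {R : Type*} [CommRing R] (x : V → R) {S : Finset V} {u v : V}
    (hu : u ∈ S) (hv : v ∈ S) (huv : u ≠ v) :
    weightedPoly G x (S.erase u) * weightedPoly G x (S.erase v) -
        weightedPoly G x S * weightedPoly G x ((S.erase u).erase v) =
      ∑ i ∈ ((S.erase u).erase v).filter (G.Adj u),
        (weightedPoly G x ((S.erase u).erase i) * weightedPoly G x ((S.erase u).erase v) -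
          weightedPoly G x (S.erase u) * weightedPoly G x (((S.erase u).erase i).erase v)) +
      if G.Adj u v then weightedPoly G x ((S.erase u).erase v) ^ 2 else 0 := by
  have huv' : u ∈ S.erase v := Finset.mem_erase.mpr ⟨huv, hu⟩
  have hvu : v ∈ S.erase u := Finset.mem_erase.mpr ⟨huv.symm, hv⟩
  rw [weightedPoly_recurrence G x hu, weightedPoly_recurrence G x huv',
    Finset.erase_right_comm (a := v) (b := u)]
  have hsum : ∑ i ∈ (S.erase u).filter (G.Adj u), weightedPoly G x ((S.erase u).erase i) =
      ∑ i ∈ ((S.erase u).erase v).filter (G.Adj u), weightedPoly G x ((S.erase u).erase i) +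
        if G.Adj u v then weightedPoly G x ((S.erase u).erase v) else 0 := by
    rw [Finset.sum_filter, Finset.sum_filter, ← Finset.sum_erase_add _ _ hvu]
  rw [hsum, Finset.sum_sub_distrib, ← Finset.sum_mul, ← Finset.mul_sum]
  simp only [Finset.erase_right_comm (a := v)]
  split_ifs <;> ring

/-- The Rayleigh inequality for real weighted matching polynomials. -/
theorem rayleigh_nonneg (x : V → ℝ) {S : Finset V} {u v : V}
    (hu : u ∈ S) (hv : v ∈ S) (huv : u ≠ v) :
    0 ≤ weightedPoly G x (S.erase u) * weightedPoly G x (S.erase v) -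
      weightedPoly G x S * weightedPoly G x ((S.erase u).erase v) := by
  induction S using Finset.strongInduction generalizing u with
  | H S ih =>
    rw [rayleigh_expand G x hu hv huv]
    refine add_nonneg (Finset.sum_nonneg fun i hi => ?_) (by positivity)
    simp only [Finset.mem_filter, Finset.mem_erase] at hi
    exact ih _ (Finset.erase_ssubset hu) (Finset.mem_erase.mpr ⟨hi.1.2.1, hi.1.2.2⟩)
      (Finset.mem_erase.mpr ⟨huv.symm, hv⟩) hi.1.1

theorem sq_le_rayleigh_of_adj (x : V → ℝ) {S : Finset V} {u v : V}
    (hu : u ∈ S) (hv : v ∈ S) (hadj : G.Adj u v) :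
    weightedPoly G x ((S.erase u).erase v) ^ 2 ≤
      weightedPoly G x (S.erase u) * weightedPoly G x (S.erase v) -
        weightedPoly G x S * weightedPoly G x ((S.erase u).erase v) := by
  rw [rayleigh_expand G x hu hv hadj.ne, if_pos hadj]
  refine le_add_of_nonneg_left (Finset.sum_nonneg fun i hi => ?_)
  simp only [Finset.mem_filter, Finset.mem_erase] at hi
  exact rayleigh_nonneg G x (Finset.mem_erase.mpr ⟨hi.1.2.1, hi.1.2.2⟩)
    (Finset.mem_erase.mpr ⟨hadj.ne', hv⟩) hi.1.1

end Rayleigh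

section Univariate

open Classical

variable [Fintype V] (G : SimpleGraph V)

/-- The matching polynomial of the subgraph induced on `S`. -/
noncomputable def inducedPoly (S : Finset V) : ℝ[X] := weightedPoly G (fun _ => X) S

theorem eval_inducedPoly (t : ℝ) (S : Finset V) :
    (inducedPoly G S).eval t = weightedPoly G (fun _ => t) S := by
  simpa [inducedPoly] using map_weightedPoly G (Polynomial.evalRingHom t) (fun _ => X) S

theorem inducedPoly_degree_coeff (S : Finset V) :
    (inducedPoly G S).natDegree ≤ S.card ∧ (inducedPoly G S).coeff S.card = 1 := by
  induction S using Finset.strongInduction with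
  | H S ih =>
    rcases S.eq_empty_or_nonempty with rfl | ⟨u, hu⟩
    · simp [inducedPoly, weightedPoly_empty]
    · have hc : S.card = (S.erase u).card + 1 := (Finset.card_erase_add_one hu).symm
      have ih1 := ih _ (Finset.erase_ssubset hu)
      have hlt : ∀ i ∈ (S.erase u).filter (G.Adj u),
          (inducedPoly G ((S.erase u).erase i)).natDegree < (S.erase u).card := fun i hi => by
        have hiS := (Finset.mem_filter.mp hi).1
        exact (ih _ ((Finset.erase_ssubset hiS).trans (Finset.erase_ssubset hu))).1.trans_lt
          (Finset.card_erase_lt_of_mem hiS)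
      have hrec : inducedPoly G S = X * inducedPoly G (S.erase u) -
          ∑ i ∈ (S.erase u).filter (G.Adj u), inducedPoly G ((S.erase u).erase i) :=
        weightedPoly_recurrence G _ hu
      rw [hrec, hc]
      constructor
      · refine (Polynomial.natDegree_sub_le _ _).trans (max_le ?_ ?_)
        · exact (Polynomial.natDegree_mul_le).trans (by
            have := Polynomial.natDegree_X_le (R := ℝ)
            omega)
        · exact Polynomial.natDegree_sum_le_of_forall_le _ _ fun i hi => by
            have := hlt i hi
            omega
      · rw [Polynomial.coeff_sub, Polynomial.coeff_X_mul, ih1.2, Polynomial.finsetSum_coeff,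
          Finset.sum_eq_zero fun i hi => ?_, sub_zero]
        exact Polynomial.coeff_eq_zero_of_natDegree_lt ((hlt i hi).trans (Nat.lt_succ_self _))

theorem inducedPoly_ne_zero (S : Finset V) : inducedPoly G S ≠ 0 := fun h => by
  simpa [h] using (inducedPoly_degree_coeff G S).2

theorem inducedPoly_recurrence {S : Finset V} {u : V} (hu : u ∈ S) :
    inducedPoly G S = X * inducedPoly G (S.erase u) -
      ∑ i ∈ (S.erase u).filter (G.Adj u), inducedPoly G ((S.erase u).erase i) :=
  weightedPoly_recurrence G _ hu

theorem derivative_inducedPoly (S : Finset V) :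
    derivative (inducedPoly G S) = ∑ v ∈ S, inducedPoly G (S.erase v) := by
  induction S using Finset.strongInduction with
  | H S ih =>
    rcases S.eq_empty_or_nonempty with rfl | ⟨u, hu⟩
    · simp [inducedPoly, weightedPoly_empty]
    · have hS2 : ∀ i ∈ (S.erase u).filter (G.Adj u),
          derivative (inducedPoly G ((S.erase u).erase i)) =
            ∑ v ∈ (S.erase u).erase i, inducedPoly G (((S.erase u).erase i).erase v) :=
        fun i hi => ih _ ((Finset.erase_ssubset (Finset.mem_filter.mp hi).1).trans
          (Finset.erase_ssubset hu))
      rw [inducedPoly_recurrence G hu, derivative_sub, derivative_mul, derivative_X, one_mul,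
        ih _ (Finset.erase_ssubset hu), derivative_sum, Finset.sum_congr rfl hS2,
        ← Finset.add_sum_erase _ _ hu, add_sub_assoc]
      congr 1
      have hrec : ∀ v ∈ S.erase u, inducedPoly G (S.erase v) =
          X * inducedPoly G ((S.erase u).erase v) -
            ∑ i ∈ ((S.erase u).erase v).filter (G.Adj u),
              inducedPoly G (((S.erase u).erase i).erase v) := fun v hv => by
        rw [inducedPoly_recurrence G (u := u) (Finset.mem_erase.mpr
          ⟨(Finset.ne_of_mem_erase hv).symm, hu⟩), Finset.erase_right_comm (a := v) (b := u)]
        simp only [Finset.erase_right_comm (a := v)]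
      rw [Finset.sum_congr rfl hrec, Finset.sum_sub_distrib, Finset.mul_sum]
      congr 1
      refine Finset.sum_comm' fun i v => ?_
      simp only [Finset.mem_filter, Finset.mem_erase]
      tauto

end Univariate

section NonnegativePolynomials

open Filter Topology

theorem eval_nonneg_of_pow_mul {P Q : ℝ[X]} {θ : ℝ} {n : ℕ} (h : P = (X - C θ) ^ n * Q)
    (hP : ∀ t, 0 ≤ P.eval t) : 0 ≤ Q.eval θ := by
  have hlim : Tendsto (fun t => Q.eval t) (𝓝[>] θ) (𝓝 (Q.eval θ)) :=
    (Q.continuous.tendsto θ).mono_left nhdsWithin_le_nhds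
  refine ge_of_tendsto hlim (eventually_mem_nhdsWithin.mono fun t ht => ?_)
  have h1 := hP t
  rw [h, eval_mul, eval_pow, eval_sub, eval_X, eval_C] at h1
  exact nonneg_of_mul_nonneg_right h1 (pow_pos (sub_pos.mpr ht) n)

theorem eval_eq_zero_of_odd_pow_mul {P Q : ℝ[X]} {θ : ℝ} {n : ℕ} (hn : Odd n)
    (h : P = (X - C θ) ^ n * Q) (hP : ∀ t, 0 ≤ P.eval t) : Q.eval θ = 0 := by
  refine le_antisymm ?_ (eval_nonneg_of_pow_mul h hP)
  have hlim : Tendsto (fun t => Q.eval t) (𝓝[<] θ) (𝓝 (Q.eval θ)) :=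
    (Q.continuous.tendsto θ).mono_left nhdsWithin_le_nhds
  refine le_of_tendsto hlim (eventually_mem_nhdsWithin.mono fun t ht => ?_)
  have h1 := hP t
  rw [h, eval_mul, eval_pow, eval_sub, eval_X, eval_C] at h1
  by_contra! hQ
  exact absurd h1 (not_le.mpr (mul_neg_of_neg_of_pos (hn.pow_neg (sub_neg.mpr ht)) hQ))

end NonnegativePolynomials

section Multiplicity

open Classical

variable [Fintype V] (θ : ℝ) (G : SimpleGraph V)

/-- The multiplicity of `θ` as a root of the matching polynomial of `G[S]`. -/
noncomputable def inducedMult (S : Finset V) : ℕ := (inducedPoly G S).rootMultiplicity θ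

theorem pow_dvd_inducedPoly_iff {S : Finset V} {n : ℕ} :
    (X - C θ) ^ n ∣ inducedPoly G S ↔ n ≤ inducedMult θ G S :=
  (le_rootMultiplicity_iff (inducedPoly_ne_zero G S)).symm

theorem exists_inducedPoly_eq {S : Finset V} {n : ℕ} (h : inducedMult θ G S = n) :
    ∃ a : ℝ[X], inducedPoly G S = (X - C θ) ^ n * a ∧ a.eval θ ≠ 0 := by
  obtain ⟨a, ha, hd⟩ := exists_eq_pow_rootMultiplicity_mul_and_not_dvd _
    (inducedPoly_ne_zero G S) θ
  refine ⟨a, by rw [← h]; exact ha, fun h0 => hd (dvd_iff_isRoot.mpr h0)⟩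

theorem inducedMult_le_erase_add_one {S : Finset V} {u : V} (hu : u ∈ S) :
    inducedMult θ G S ≤ inducedMult θ G (S.erase u) + 1 := by
  by_contra! hlt
  obtain ⟨b, hb, hb0⟩ := exists_inducedPoly_eq θ G (S := S.erase u) rfl
  set l := inducedMult θ G (S.erase u)
  set f := inducedPoly G S with hf
  set g := inducedPoly G (S.erase u) with hg
  have hfd : (X - C θ) ^ (l + 2) ∣ f := (pow_dvd_inducedPoly_iff θ G).mpr (by omega)
  have hgd : (X - C θ) ^ l ∣ g := ⟨b, hb⟩
  have hfd' : (X - C θ) ^ (l + 1) ∣ derivative f := by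
    simpa using pow_sub_one_dvd_derivative_of_pow_dvd hfd
  have hgd' : (X - C θ) ^ (l - 1) ∣ derivative g := pow_sub_one_dvd_derivative_of_pow_dvd hgd
  have hW : (X - C θ) ^ (2 * l + 1) ∣ derivative f * g - f * derivative g := by
    have h1 := mul_dvd_mul hfd' hgd
    have h2 := mul_dvd_mul hfd hgd'
    rw [← pow_add] at h1 h2
    exact dvd_sub ((pow_dvd_pow _ (by omega)).trans h1) ((pow_dvd_pow _ (by omega)).trans h2)
  obtain ⟨c, hc⟩ := hW
  have hfact : derivative f * g - f * derivative g - g ^ 2 =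
      (X - C θ) ^ (2 * l) * ((X - C θ) * c - b ^ 2) := by
    rw [hc, hb]
    ring
  have hpos : ∀ t, 0 ≤ (derivative f * g - f * derivative g - g ^ 2).eval t := by
    intro t
    have hexp : derivative f * g - f * derivative g - g ^ 2 = ∑ v ∈ S.erase u,
        (g * inducedPoly G (S.erase v) - f * inducedPoly G ((S.erase u).erase v)) := by
      rw [hf, hg, derivative_inducedPoly, derivative_inducedPoly, ← Finset.add_sum_erase _ _ hu,
        Finset.sum_sub_distrib, ← Finset.mul_sum, ← Finset.mul_sum]
      ring
    rw [hexp, eval_finsetSum]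
    refine Finset.sum_nonneg fun v hv => ?_
    simp only [hf, hg, eval_sub, eval_mul, eval_inducedPoly]
    exact rayleigh_nonneg G _ hu (Finset.mem_of_mem_erase hv) (Finset.ne_of_mem_erase hv).symm
  have h0 := eval_nonneg_of_pow_mul hfact hpos
  simp only [eval_sub, eval_mul, eval_X, eval_C, sub_self, zero_mul, eval_pow, zero_sub] at h0
  have := pow_pos (abs_pos.mpr hb0) 2
  rw [sq_abs] at this
  linarith

theorem inducedMult_erase_le_add_one {S : Finset V} {u : V} (hu : u ∈ S) :
    inducedMult θ G (S.erase u) ≤ inducedMult θ G S + 1 := by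
  have h : inducedMult θ G (S.erase u) - 1 ≤ inducedMult θ G S := by
    rw [← pow_dvd_inducedPoly_iff, inducedPoly_recurrence G hu]
    refine dvd_sub (dvd_mul_of_dvd_right ((pow_dvd_inducedPoly_iff θ G).mpr (by omega)) _)
      (Finset.dvd_sum fun i hi => (pow_dvd_inducedPoly_iff θ G).mpr ?_)
    have := inducedMult_le_erase_add_one θ G (Finset.mem_filter.mp hi).1
    omega
  omega

/-- Deleting two positive vertices never raises the multiplicity by exactly one. -/
theorem inducedMult_erase_erase_ne {S : Finset V} {u v : V} (hu : u ∈ S) (hv : v ∈ S)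
    (huv : u ≠ v) (hmu : inducedMult θ G (S.erase u) = inducedMult θ G S + 1)
    (hmv : inducedMult θ G (S.erase v) = inducedMult θ G S + 1) :
    inducedMult θ G ((S.erase u).erase v) ≠ inducedMult θ G S + 1 := by
  intro huv1
  obtain ⟨a, ha, -⟩ := exists_inducedPoly_eq θ G hmu
  obtain ⟨b, hb, -⟩ := exists_inducedPoly_eq θ G hmv
  obtain ⟨c, hc, hc0⟩ := exists_inducedPoly_eq θ G (S := S) rfl
  obtain ⟨d, hd, hd0⟩ := exists_inducedPoly_eq θ G huv1
  set k := inducedMult θ G S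
  have hfact : inducedPoly G (S.erase u) * inducedPoly G (S.erase v) -
      inducedPoly G S * inducedPoly G ((S.erase u).erase v) =
        (X - C θ) ^ (2 * k + 1) * ((X - C θ) * a * b - c * d) := by
    rw [ha, hb, hc, hd]
    ring
  have h0 := eval_eq_zero_of_odd_pow_mul ⟨k, rfl⟩ hfact fun t => by
    simp only [eval_sub, eval_mul, eval_inducedPoly]
    exact rayleigh_nonneg G _ hu hv huv
  simp [hc0, hd0] at h0

/-- If `u` is adjacent to an essential vertex `w` and `u`, `v` are positive, then `v` remains
positive after deleting `u`. -/
theorem inducedMult_erase_erase_of_adj {S : Finset V} {u v w : V} (hu : u ∈ S) (hv : v ∈ S)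
    (hw : w ∈ S) (huv : u ≠ v) (hadj : G.Adj u w)
    (hmu : inducedMult θ G (S.erase u) = inducedMult θ G S + 1)
    (hmv : inducedMult θ G (S.erase v) = inducedMult θ G S + 1)
    (hmw : inducedMult θ G (S.erase w) + 1 = inducedMult θ G S) :
    inducedMult θ G ((S.erase u).erase v) = inducedMult θ G S + 2 := by
  have huw : u ≠ w := hadj.ne
  have hvw : v ≠ w := by
    rintro rfl
    omega
  obtain ⟨k, hk⟩ : ∃ k, inducedMult θ G (S.erase w) = k := ⟨_, rfl⟩
  have hS : inducedMult θ G S = k + 1 := by omega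
  have hu' : inducedMult θ G (S.erase u) = k + 2 := by omega
  have hv' : inducedMult θ G (S.erase v) = k + 2 := by omega
  by_contra hne
  have hvSu : v ∈ S.erase u := Finset.mem_erase.mpr ⟨huv.symm, hv⟩
  have hwSu : w ∈ S.erase u := Finset.mem_erase.mpr ⟨huw.symm, hw⟩
  have hwSv : w ∈ S.erase v := Finset.mem_erase.mpr ⟨hvw.symm, hw⟩
  have huSw : u ∈ S.erase w := Finset.mem_erase.mpr ⟨huw, hu⟩
  have hvSw : v ∈ S.erase w := Finset.mem_erase.mpr ⟨hvw, hv⟩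
  have huSv : u ∈ S.erase v := Finset.mem_erase.mpr ⟨huv, hu⟩
  have huv' : inducedMult θ G ((S.erase u).erase v) = k + 1 := by
    have h1 := inducedMult_erase_le_add_one θ G hvSu
    have h2 := inducedMult_le_erase_add_one θ G hvSu
    have h3 := inducedMult_erase_erase_ne θ G hu hv huv hmu hmv
    omega
  have huw' : inducedMult θ G ((S.erase u).erase w) = k + 1 := by
    have h1 := inducedMult_le_erase_add_one θ G hwSu
    have h2 := inducedMult_erase_le_add_one θ G huSw
    rw [Finset.erase_right_comm] at h2
    omega
  have hvw' : inducedMult θ G ((S.erase v).erase w) = k + 1 := by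
    have h1 := inducedMult_le_erase_add_one θ G hwSv
    have h2 := inducedMult_erase_le_add_one θ G hvSw
    rw [Finset.erase_right_comm] at h2
    omega
  obtain ⟨a₁, ha₁, -⟩ := exists_inducedPoly_eq θ G hu'
  obtain ⟨a₂, ha₂, -⟩ := exists_inducedPoly_eq θ G huw'
  obtain ⟨b₁, hb₁, -⟩ := exists_inducedPoly_eq θ G hv'
  obtain ⟨b₂, hb₂, -⟩ := exists_inducedPoly_eq θ G hvw'
  obtain ⟨c₀, hc₀, -⟩ := exists_inducedPoly_eq θ G hS
  obtain ⟨c₁, hc₁, hc₁0⟩ := exists_inducedPoly_eq θ G hk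
  obtain ⟨d₀, hd₀, hd₀0⟩ := exists_inducedPoly_eq θ G huv'
  have hwSuv : w ∈ (S.erase u).erase v := Finset.mem_erase.mpr ⟨hvw.symm, hwSu⟩
  have huvw : k + 1 ≤ inducedMult θ G (((S.erase u).erase v).erase w) := by
    by_contra! hlt
    have h1 := inducedMult_le_erase_add_one θ G hwSuv
    have heq : inducedMult θ G (((S.erase u).erase v).erase w) = k := by omega
    obtain ⟨d, hd, hd0⟩ := exists_inducedPoly_eq θ G heq
    have hfact : inducedPoly G ((S.erase u).erase v) * inducedPoly G ((S.erase v).erase w) -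
        inducedPoly G (S.erase v) * inducedPoly G (((S.erase u).erase v).erase w) -
          inducedPoly G (((S.erase u).erase v).erase w) ^ 2 =
        (X - C θ) ^ (2 * k) * ((X - C θ) * ((X - C θ) * (d₀ * b₂ - b₁ * d)) - d ^ 2) := by
      rw [hd₀, hb₂, hb₁, hd]
      ring
    have h0 := eval_nonneg_of_pow_mul hfact fun t => by
      simp only [eval_sub, eval_mul, eval_pow, eval_inducedPoly]
      have := sq_le_rayleigh_of_adj G (fun _ => t) huSv hwSv hadj
      rw [Finset.erase_right_comm (a := v) (b := u)] at this
      linarith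
    simp only [eval_sub, eval_mul, eval_X, eval_C, sub_self, zero_mul, eval_pow, zero_sub] at h0
    have := pow_pos (abs_pos.mpr hd0) 2
    rw [sq_abs] at this
    linarith
  obtain ⟨d₁, hd₁⟩ := (pow_dvd_inducedPoly_iff θ G).mpr huvw
  have hlin : ∀ z : ℝ, (c₀.eval θ + z * c₁.eval θ) * d₀.eval θ ≤ 0 := by
    intro z
    have hfact : (inducedPoly G (S.erase u) +
          C z * (X - C θ) * inducedPoly G ((S.erase u).erase w)) *
        (inducedPoly G (S.erase v) + C z * (X - C θ) * inducedPoly G ((S.erase v).erase w)) -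
        (inducedPoly G S + C z * (X - C θ) * inducedPoly G (S.erase w)) *
        (inducedPoly G ((S.erase u).erase v) +
          C z * (X - C θ) * inducedPoly G (((S.erase u).erase v).erase w)) =
        (X - C θ) ^ (2 * (k + 1)) * ((X - C θ) * ((X - C θ) * ((a₁ + C z * a₂) *
          (b₁ + C z * b₂))) - (c₀ + C z * c₁) * (d₀ + (X - C θ) * (C z * d₁))) := by
      rw [ha₁, ha₂, hb₁, hb₂, hc₀, hc₁, hd₀, hd₁]
      ring
    have h0 := eval_nonneg_of_pow_mul hfact fun t => by
      simp only [eval_sub, eval_mul, eval_add, eval_X, eval_C, eval_inducedPoly]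
      rw [← weightedPoly_update_add G _ hwSu, ← weightedPoly_update_add G _ hwSv,
        ← weightedPoly_update_add G _ hw, ← weightedPoly_update_add G _ hwSuv]
      exact rayleigh_nonneg G _ hu hv huv
    simp only [eval_sub, eval_mul, eval_add, eval_X, eval_C, sub_self, zero_mul, add_zero,
      zero_sub] at h0
    linarith
  have h1 := hlin ((d₀.eval θ - c₀.eval θ) / c₁.eval θ)
  rw [div_mul_cancel₀ _ hc₁0, add_sub_cancel] at h1
  exact hd₀0 (mul_self_eq_zero.mp (le_antisymm h1 (mul_self_nonneg _)))

theorem inducedMult_union {S T : Finset V} (hd : Disjoint S T)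
    (hST : ∀ a ∈ S, ∀ b ∈ T, ¬ G.Adj a b) :
    inducedMult θ G (S ∪ T) = inducedMult θ G S + inducedMult θ G T := by
  have h : inducedPoly G (S ∪ T) = inducedPoly G S * inducedPoly G T :=
    weightedPoly_union G _ hd hST
  rw [inducedMult, h, rootMultiplicity_mul
    (mul_ne_zero (inducedPoly_ne_zero G S) (inducedPoly_ne_zero G T))]
  rfl

theorem inducedMult_sdiff_le {S T : Finset V} (h : T ⊆ S) :
    inducedMult θ G (S \ T) ≤ inducedMult θ G S + T.card := by
  induction T using Finset.induction_on with
  | empty => simp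
  | insert a T ha ih =>
    have h1 : a ∈ S \ T := Finset.mem_sdiff.mpr ⟨h (Finset.mem_insert_self a T), ha⟩
    have h2 := ih ((Finset.subset_insert a T).trans h)
    have h3 := inducedMult_erase_le_add_one θ G h1
    rw [Finset.sdiff_insert, Finset.card_insert_of_notMem ha]
    omega

end Multiplicity

section Bridge

open Classical

theorem numMatchings_eq_card [Fintype V] (G : SimpleGraph V) (r : ℕ) :
    numMatchings G r = ((matchingsIn G Finset.univ).filter fun M => M.card = r).card := by
  refine Nat.subtype_card _ fun M => ?_
  simp [mem_matchingsIn]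
  tauto

theorem card_uncovered_add [Fintype V] {G : SimpleGraph V} {M : Finset (Sym2 V)}
    (hM : M ∈ matchingsIn G Finset.univ) :
    (Finset.univ.filter fun v => ∀ e ∈ M, v ∉ e).card + 2 * M.card = Nat.card V := by
  obtain ⟨h1, h2, -⟩ := mem_matchingsIn.mp hM
  have hcov : (Finset.univ.filter fun v => ¬ ∀ e ∈ M, v ∉ e) = M.biUnion Sym2.toFinset := by
    ext v
    simp
  have hcard : (M.biUnion Sym2.toFinset).card = 2 * M.card := by
    rw [Finset.card_biUnion, Finset.sum_congr rfl fun e he =>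
      Sym2.card_toFinset_of_not_isDiag e (G.not_isDiag_of_mem_edgeSet (h1 he))]
    · simp [mul_comm]
    · intro e he f hf hne
      refine Finset.disjoint_left.mpr fun v hv hv' => ?_
      exact h2 he hf hne v (Sym2.mem_toFinset.mp hv) (Sym2.mem_toFinset.mp hv')
  rw [← hcard, ← hcov, Finset.card_filter_add_card_filter_not, Nat.card_eq_fintype_card,
    Finset.card_univ]

theorem matchingPoly_eq [Fintype V] (G : SimpleGraph V) :
    matchingPoly G = inducedPoly G Finset.univ := by
  rw [matchingPoly, inducedPoly, weightedPoly, ← Finset.sum_fiberwise_of_maps_to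
    (s := matchingsIn G Finset.univ) (t := Finset.range (Nat.card V + 1)) (g := Finset.card)]
  · refine Finset.sum_congr rfl fun r _ => ?_
    rw [numMatchings_eq_card, Finset.sum_congr rfl (g := fun _ => C ((-1 : ℝ) ^ r) *
      (X : ℝ[X]) ^ (Nat.card V - 2 * r)), Finset.sum_const, nsmul_eq_mul]
    · simp only [C_mul, map_natCast]
      ring
    · intro M hM
      obtain ⟨hM', rfl⟩ := Finset.mem_filter.mp hM
      have := card_uncovered_add hM'
      rw [Finset.prod_const, ← this, Nat.add_sub_cancel]
      simp
  · intro M hM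
    have := card_uncovered_add hM
    rw [Finset.mem_range]
    omega

variable (θ : ℝ)

theorem mult_eq [Fintype V] (G : SimpleGraph V) : mult θ G = inducedMult θ G Finset.univ := by
  rw [mult, matchingPoly_eq, inducedMult]

theorem inducedMult_map {W : Type*} [Fintype V] [Fintype W] {G : SimpleGraph V}
    {H : SimpleGraph W} (f : H ↪g G) (S : Finset W) :
    inducedMult θ H S = inducedMult θ G (S.map f.toEmbedding) := by
  rw [inducedMult, inducedMult, inducedPoly, inducedPoly, ← weightedPoly_map]

theorem mult_induce [Fintype V] (G : SimpleGraph V) (s : Set V) [Fintype s] :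
    mult θ (G.induce s) = inducedMult θ G s.toFinset := by
  rw [mult_eq, inducedMult_map θ (SimpleGraph.Embedding.induce s)]
  rfl

theorem mult_deleteVert [Fintype V] (G : SimpleGraph V) (v : V) :
    mult θ (deleteVert G v) = inducedMult θ G (Finset.univ.erase v) := by
  rw [deleteVert, mult_induce]
  congr 1
  ext
  simp

theorem mult_deleteVert_induce [Fintype V] (G : SimpleGraph V) (s : Set V) [Fintype s] (v : s) :
    mult θ (deleteVert (G.induce s) v) = inducedMult θ G (s.toFinset.erase v) := by
  rw [mult_deleteVert, inducedMult_map θ (SimpleGraph.Embedding.induce s)]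
  congr 1
  ext w
  simp

end Bridge

section Components

open Classical

variable (θ : ℝ) (H : SimpleGraph V)

theorem critical_indicator_le (c : H.ConnectedComponent) :
    (if IsCritical θ (H.induce c.supp) then 1 else 0) ≤ mult θ (H.induce c.supp) := by
  split_ifs with h
  · exact h.2.ge
  · exact Nat.zero_le _

variable [Fintype V]

theorem inducedMult_biUnion_supp (t : Finset H.ConnectedComponent) :
    inducedMult θ H (t.biUnion fun c => c.supp.toFinset) =
      ∑ c ∈ t, mult θ (H.induce c.supp) := by
  induction t using Finset.induction_on with
  | empty => simp [inducedMult, inducedPoly, weightedPoly_empty]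
  | insert c t hc ih =>
    rw [Finset.biUnion_insert, inducedMult_union θ H ?_ ?_, ih, Finset.sum_insert hc, mult_induce]
    · rw [Finset.disjoint_biUnion_right]
      intro c' hc'
      rw [Set.disjoint_toFinset]
      exact H.pairwise_disjoint_supp_connectedComponent fun h => hc (h ▸ hc')
    · intro a ha b hb hab
      simp only [Finset.mem_biUnion, Set.mem_toFinset, SimpleGraph.ConnectedComponent.mem_supp_iff]
        at ha hb
      obtain ⟨c', hc', rfl⟩ := hb
      rw [← ha, SimpleGraph.ConnectedComponent.connectedComponentMk_eq_of_adj hab] at hc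
      exact hc hc'

theorem mult_eq_sum_components :
    mult θ H = ∑ c : H.ConnectedComponent, mult θ (H.induce c.supp) := by
  rw [← inducedMult_biUnion_supp, mult_eq]
  congr 1
  ext v
  simp

theorem numCritComponents_eq_sum :
    numCritComponents θ H =
      ∑ c : H.ConnectedComponent, if IsCritical θ (H.induce c.supp) then 1 else 0 := by
  rw [← Finset.card_filter]
  exact Nat.subtype_card _ fun c => by simp

theorem numCritComponents_le_mult : numCritComponents θ H ≤ mult θ H := by
  rw [numCritComponents_eq_sum, mult_eq_sum_components]
  exact Finset.sum_le_sum fun c _ => critical_indicator_le θ H c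

theorem isEssential_component_iff {c : H.ConnectedComponent} (v : c.supp) :
    IsEssential θ (H.induce c.supp) v ↔ IsEssential θ H v := by
  have hno : ∀ a ∈ c.supp.toFinset, ∀ b ∈ c.supp.toFinsetᶜ, ¬ H.Adj a b := by
    intro a ha b hb hab
    simp only [Finset.mem_compl, Set.mem_toFinset,
      SimpleGraph.ConnectedComponent.mem_supp_iff] at ha hb
    exact hb (by rw [← SimpleGraph.ConnectedComponent.connectedComponentMk_eq_of_adj hab, ha])
  have h1 := inducedMult_union θ H disjoint_compl_right hno
  have h2 := inducedMult_union θ H (S := c.supp.toFinset.erase v)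
    (disjoint_compl_right.mono_left (Finset.erase_subset _ _))
    fun a ha => hno a (Finset.mem_of_mem_erase ha)
  have h3 : c.supp.toFinset.erase v ∪ c.supp.toFinsetᶜ = Finset.univ.erase (v : V) := by
    rw [← Finset.union_compl c.supp.toFinset, Finset.erase_union_distrib,
      Finset.erase_eq_of_notMem (s := c.supp.toFinsetᶜ)]
    simp
  rw [Finset.union_compl] at h1
  rw [h3] at h2
  rw [IsEssential, IsEssential, mult_deleteVert_induce, mult_deleteVert, mult_induce, mult_eq]
  omega

/-- If all the multiplicity of `H` comes from critical components, then every neighbour of an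
essential vertex is essential. -/
theorem isEssential_of_adj (hH : numCritComponents θ H = mult θ H) {v w : V}
    (hw : IsEssential θ H w) (hadj : H.Adj v w) : IsEssential θ H v := by
  rw [numCritComponents_eq_sum, mult_eq_sum_components,
    Finset.sum_eq_sum_iff_of_le fun c _ => critical_indicator_le θ H c] at hH
  have hwc : w ∈ (H.connectedComponentMk v).supp :=
    (SimpleGraph.ConnectedComponent.connectedComponentMk_eq_of_adj hadj).symm
  have h1 := hH (H.connectedComponentMk v) (Finset.mem_univ _)
  have h2 := (isEssential_component_iff θ H ⟨w, hwc⟩).mpr hw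
  have hcrit : IsCritical θ (H.induce (H.connectedComponentMk v).supp) := by
    by_contra hc
    rw [if_neg hc] at h1
    rw [IsEssential] at h2
    omega
  exact (isEssential_component_iff θ H ⟨v, rfl⟩).mp (hcrit.1 _)

end Components

section Barrier

open Classical

variable [Fintype V] {θ : ℝ} {G : SimpleGraph V}

/-- In the complement of an extreme set, every subset of the set is extreme too. -/
theorem inducedMult_compl_of_subset (hG : inducedMult θ G Finset.univ = 0) {S T : Finset V}
    (hS : S.card ≤ inducedMult θ G Sᶜ) (hT : T ⊆ S) : inducedMult θ G Tᶜ = T.card := by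
  have h1 := inducedMult_sdiff_le θ G (Finset.subset_univ T)
  have h2 := inducedMult_sdiff_le θ G (S := Tᶜ) (T := S \ T) fun v hv =>
    Finset.mem_compl.mpr (Finset.mem_sdiff.mp hv).2
  have h3 : Tᶜ \ (S \ T) = Sᶜ := by
    ext v
    have := @hT v
    simp only [Finset.mem_sdiff, Finset.mem_compl]
    tauto
  rw [← Finset.compl_eq_univ_sdiff, hG] at h1
  rw [h3] at h2
  have := Finset.card_sdiff_add_card_eq_card hT
  omega

/-- In an elementary graph with a barrier `S`, a vertex `v` outside `S` is essential after deleting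
any single vertex `x` of `S`. -/
theorem inducedMult_pair_eq_zero (hG : inducedMult θ G Finset.univ = 0)
    (hG1 : ∀ v, inducedMult θ G (Finset.univ.erase v) = 1)
    (hpos : ∀ x v, v ≠ x → inducedMult θ G ((Finset.univ.erase x).erase v) = 2 →
      ∃ w, w ≠ x ∧ G.Adj v w ∧ inducedMult θ G ((Finset.univ.erase x).erase w) = 0)
    {S : Finset V} (hS : inducedMult θ G Sᶜ = S.card)
    (hadj : ∀ v w, v ∉ S → w ∉ S → G.Adj v w →
      inducedMult θ G (Sᶜ.erase w) + 1 = S.card → inducedMult θ G (Sᶜ.erase v) + 1 = S.card)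
    {x v : V} (hx : x ∈ S) (hv : v ∉ S) :
    inducedMult θ G ((Finset.univ.erase x).erase v) = 0 := by
  have hvx : v ≠ x := fun h => hv (h ▸ hx)
  by_contra hne
  have hsub : ∀ {T : Finset V}, T ⊆ S → inducedMult θ G Tᶜ = T.card := fun hT =>
    inducedMult_compl_of_subset hG hS.ge hT
  have hpair : ∀ a b : V, (Finset.univ.erase a).erase b = ({b, a} : Finset V)ᶜ := fun a b => by
    rw [Finset.compl_insert, Finset.compl_singleton]
  have hv2 : inducedMult θ G ((Finset.univ.erase x).erase v) = 2 := by
    have h1 := inducedMult_erase_le_add_one θ G (S := Finset.univ.erase x) (u := v) (by simp [hvx])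
    have h2 := inducedMult_erase_erase_ne θ G (Finset.mem_univ x) (Finset.mem_univ v) hvx.symm
      (by rw [hG, hG1]) (by rw [hG, hG1])
    rw [hG1] at h1
    omega
  obtain ⟨w, hwx, hvw, hw⟩ := hpos x v hvx hv2
  have hwS : w ∉ S := fun h => by
    have := hsub (T := {w, x}) (by simp [Finset.insert_subset_iff, h, hx])
    rw [← hpair, hw, Finset.card_pair hwx] at this
    omega
  have hess : ∀ T ⊆ S, x ∈ T → inducedMult θ G (Tᶜ.erase w) + 1 = T.card := by
    intro T hT hxT
    have hwT : w ∉ T := fun h => hwS (hT h)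
    have h1 := inducedMult_sdiff_le θ G (S := (Finset.univ.erase x).erase w) (T := T.erase x)
      fun a ha => by
        simp only [Finset.mem_erase] at ha ⊢
        exact ⟨fun h => hwT (h ▸ ha.2), ha.1, Finset.mem_univ a⟩
    have h2 : (Finset.univ.erase x).erase w \ T.erase x = Tᶜ.erase w := by
      ext a
      simp only [Finset.mem_sdiff, Finset.mem_erase, Finset.mem_compl, Finset.mem_univ]
      grind
    have h3 := inducedMult_le_erase_add_one θ G (S := Tᶜ) (u := w) (by simpa using hwT)
    have h4 := Finset.card_erase_add_one hxT
    rw [h2, hw] at h1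
    rw [hsub hT] at h3
    omega
  have hpositive : ∀ T ⊆ S.erase x,
      inducedMult θ G ((insert x T)ᶜ.erase v) = (insert x T).card + 1 := by
    intro T
    induction T using Finset.induction_on with
    | empty =>
      intro _
      rw [insert_empty_eq, Finset.compl_singleton, hv2, Finset.card_singleton]
    | insert s T hs ih =>
      intro hT
      have hTS : T ⊆ S.erase x := (Finset.subset_insert s T).trans hT
      obtain ⟨hsx, hsS⟩ := Finset.mem_erase.mp (hT (Finset.mem_insert_self s T))
      have hxT : insert x T ⊆ S :=
        Finset.insert_subset hx (hTS.trans (Finset.erase_subset _ _))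
      have hsxT : s ∉ insert x T := by simp [hsx, hs]
      have hc := Finset.card_insert_of_notMem hsxT
      have hsxT' : insert s (insert x T) ⊆ S := Finset.insert_subset hsS hxT
      have h1 := hsub hxT
      have h2 := hsub hsxT'
      rw [Finset.compl_insert, hc] at h2
      have h3 := inducedMult_erase_erase_of_adj θ G (S := (insert x T)ᶜ) (u := v) (v := s) (w := w)
        (Finset.mem_compl.mpr fun h => hv (hxT h)) (Finset.mem_compl.mpr hsxT)
        (Finset.mem_compl.mpr fun h => hwS (hxT h)) (fun h => hv (h ▸ hsS)) hvw
        (by rw [ih hTS, h1]) (by rw [h2, h1])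
        (by rw [h1]; exact hess _ hxT (Finset.mem_insert_self x T))
      rw [Finset.insert_comm, Finset.compl_insert, Finset.erase_right_comm, h3, h1, hc]
  have h1 := hpositive _ subset_rfl
  have h2 := hadj v w hv hwS hvw (hess S subset_rfl hx)
  rw [Finset.insert_erase hx] at h1
  omega

end Barrier

/-- In a θ-elementary graph, for ∅ ≠ X ⊆ S a θ-barrier set, A_θ(G\X) = S \ X and
P_θ(G\X) ∪ N_θ(G\X) = ∅. -/
theorem stmt_9 {V : Type*} [Fintype V] (θ : ℝ) (G : SimpleGraph V)
    (h : IsElementary θ G) (S : Set V) (hS : IsBarrier θ G S) (hSne : S.Nonempty)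
    (X : Set V) (hXS : X ⊆ S) (hXne : X.Nonempty) :
    Subtype.val '' specialSet θ (deleteSet G X) = S \ X ∧
      positiveSet θ (deleteSet G X) = ∅ ∧ neutralSet θ (deleteSet G X) = ∅ := by

  classical
  obtain ⟨⟨hG0, hG1⟩, hP⟩ := h
  have hG : inducedMult θ G Finset.univ = 0 := by rw [← mult_eq, hG0]
  simp only [mult_deleteVert] at hG1
  have hcoe : ∀ (A : Set V) [Fintype ↥Aᶜ], Aᶜ.toFinset = A.toFinsetᶜ := fun A _ => by
    ext v
    simp
  have hmult : ∀ A : Set V, mult θ (deleteSet G A) = inducedMult θ G A.toFinsetᶜ := fun A => by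
    rw [deleteSet, mult_induce, hcoe]
  have hmult_vert : ∀ (A : Set V) (v : ↥Aᶜ), mult θ (deleteVert (deleteSet G A) v) =
      inducedMult θ G (A.toFinsetᶜ.erase v) := fun A v => by
    rw [deleteSet, mult_deleteVert_induce, hcoe]
  have hpos : ∀ x v, v ≠ x → inducedMult θ G ((Finset.univ.erase x).erase v) = 2 →
      ∃ w, w ≠ x ∧ G.Adj v w ∧ inducedMult θ G ((Finset.univ.erase x).erase w) = 0 := by
    intro x v hvx hv
    have hx1 : mult θ (deleteVert G x) = 1 := by rw [mult_deleteVert, hG1]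
    have hx2 : ∀ u : ({x}ᶜ : Set V), mult θ (deleteVert (deleteVert G x) u) =
        inducedMult θ G ((Finset.univ.erase x).erase u) := fun u => by
      rw [show deleteVert G x = deleteSet G {x} from rfl, hmult_vert, Set.toFinset_singleton,
        Finset.compl_singleton]
    have hvpos : IsPositive θ (deleteVert G x) ⟨v, hvx⟩ := by
      rw [IsPositive, hx1, hx2, hv]
    have hspec : IsSpecial θ (deleteVert G x) ⟨v, hvx⟩ := by
      by_contra hns
      have : (⟨v, hvx⟩ : ({x}ᶜ : Set V)) ∈ positiveSet θ (deleteVert G x) := ⟨hvpos, hns⟩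
      rw [hP x] at this
      exact this
    obtain ⟨-, ⟨w, hwx⟩, hadj, hw⟩ := hspec
    rw [IsEssential, hx1, hx2] at hw
    exact ⟨w, hwx, hadj, by simpa using hw⟩
  have hcard : numCritComponents θ (deleteSet G S) = S.toFinset.card := by
    rw [hS, hG0, zero_add, Set.ncard_eq_toFinset_card']
  have hSge : S.toFinset.card ≤ inducedMult θ G S.toFinsetᶜ := by
    rw [← hcard, ← hmult]
    exact numCritComponents_le_mult θ _
  have hsub : ∀ {T : Finset V}, T ⊆ S.toFinset → inducedMult θ G Tᶜ = T.card := fun hT =>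
    inducedMult_compl_of_subset hG hSge hT
  have hadj : ∀ v w, v ∉ S.toFinset → w ∉ S.toFinset → G.Adj v w →
      inducedMult θ G (S.toFinsetᶜ.erase w) + 1 = S.toFinset.card →
      inducedMult θ G (S.toFinsetᶜ.erase v) + 1 = S.toFinset.card := by
    intro v w hv hw hvw hess
    rw [Set.mem_toFinset] at hv hw
    have h1 := isEssential_of_adj θ (deleteSet G S) (v := ⟨v, hv⟩) (w := ⟨w, hw⟩)
      (by rw [hcard, hmult, hsub subset_rfl])
      (by rw [IsEssential, hmult, hmult_vert, hsub subset_rfl]; exact hess) hvw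
    rwa [IsEssential, hmult, hmult_vert, hsub subset_rfl] at h1
  have hout : ∀ {x v : V}, x ∈ S → v ∉ S →
      inducedMult θ G ((Finset.univ.erase x).erase v) = 0 := fun hx hv =>
    inducedMult_pair_eq_zero hG hG1 hpos (hsub subset_rfl) hadj (Set.mem_toFinset.mpr hx)
      (Set.mem_toFinset.not.mpr hv)
  obtain ⟨x, hxX⟩ := hXne
  have hXS' : X.toFinset ⊆ S.toFinset := Set.toFinset_subset_toFinset.mpr hXS
  have hX : mult θ (deleteSet G X) = X.toFinset.card := by rw [hmult, hsub hXS']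
  have hin_mult : ∀ v : ↥Xᶜ, (v : V) ∈ S →
      mult θ (deleteVert (deleteSet G X) v) = mult θ (deleteSet G X) + 1 := by
    intro v hv
    have hvX : (v : V) ∉ X.toFinset := Set.mem_toFinset.not.mpr v.2
    rw [hX, hmult_vert, ← Finset.compl_insert,
      hsub (Finset.insert_subset (Set.mem_toFinset.mpr hv) hXS'),
      Finset.card_insert_of_notMem hvX]
  have hout_ess : ∀ v : ↥Xᶜ, (v : V) ∉ S → IsEssential θ (deleteSet G X) v := by
    intro v hv
    have hvX : (v : V) ∉ X.toFinset := Set.mem_toFinset.not.mpr v.2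
    have hxX' : x ∈ X.toFinset := Set.mem_toFinset.mpr hxX
    have h1 := inducedMult_sdiff_le θ G (S := (Finset.univ.erase x).erase v)
      (T := X.toFinset.erase x) fun a ha => by
        simp only [Finset.mem_erase] at ha ⊢
        exact ⟨fun h => hvX (h ▸ ha.2), ha.1, Finset.mem_univ a⟩
    have h2 : (Finset.univ.erase x).erase (v : V) \ X.toFinset.erase x =
        X.toFinsetᶜ.erase v := by
      ext a
      simp only [Finset.mem_sdiff, Finset.mem_erase, Finset.mem_compl, Finset.mem_univ]
      grind
    have h3 := inducedMult_le_erase_add_one θ G (S := X.toFinsetᶜ) (u := v)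
      (Finset.mem_compl.mpr hvX)
    have h4 := Finset.card_erase_add_one hxX'
    rw [h2, hout (hXS hxX) hv] at h1
    rw [hsub hXS'] at h3
    rw [IsEssential, hX, hmult_vert]
    omega
  have hin_spec : ∀ v : ↥Xᶜ, (v : V) ∈ S → IsSpecial θ (deleteSet G X) v := by
    intro v hv
    have hvx : (v : V) ≠ x := fun h => v.2 (h ▸ hxX)
    refine ⟨fun hess => ?_, ?_⟩
    · have := hin_mult v hv
      rw [IsEssential] at hess
      omega
    · have hpair : ∀ a ∈ S, a ≠ x → inducedMult θ G ((Finset.univ.erase x).erase a) = 2 := by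
        intro a ha hax
        have := hsub (T := {a, x}) (Finset.insert_subset (Set.mem_toFinset.mpr ha)
          (Finset.singleton_subset_iff.mpr (Set.mem_toFinset.mpr (hXS hxX))))
        rwa [Finset.compl_insert, Finset.compl_singleton, Finset.card_pair hax] at this
      obtain ⟨w, hwx, hvw, hw⟩ := hpos x v hvx (hpair v hv hvx)
      have hwS : w ∉ S := fun h => by
        have := hpair w h hwx
        omega
      exact ⟨⟨w, fun h => hwS (hXS h)⟩, hvw, hout_ess _ hwS⟩
  refine ⟨?_, ?_, ?_⟩
  · ext v
    constructor
    · rintro ⟨v, hv, rfl⟩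
      exact ⟨by_contra fun h => hv.1 (hout_ess v h), v.2⟩
    · rintro ⟨hv, hvX⟩
      exact ⟨⟨v, hvX⟩, hin_spec ⟨v, hvX⟩ hv, rfl⟩
  · refine Set.eq_empty_of_forall_notMem fun v ⟨hv, hns⟩ => ?_
    by_cases hvS : (v : V) ∈ S
    · exact hns (hin_spec v hvS)
    · have := hout_ess v hvS
      rw [IsPositive] at hv
      rw [IsEssential] at this
      omega
  · refine Set.eq_empty_of_forall_notMem fun v (hv : _ = _) => ?_
    by_cases hvS : (v : V) ∈ S
    · have := hin_mult v hvS
      omega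
    · have := hout_ess v hvS
      rw [IsEssential] at this
      omega

end MatchPoly
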